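/- For every natural number n there exists a natural number k such that the counting modality C_k is not expressible in TL_n over the real line: there is no TL_n formula φ (in the single atom p) such that for every subset P ⊆ ℝ, the truth set of φ in the structure (ℝ, <, B, P) equals {t ∈ ℝ : P ∩ (t, t+1) contains at least k points}. In particular, no temporal logic all of whose modalities have truth tables of quantifier depth at most n in L can express all the counting modalities C_k over ℝ. -/

import Mathlib

/-- Formulas of second-order monadic logic of order `L` over the signature `<`, `B`, `P`,
in de Bruijn style: `Fml m n` has first-order variables `Fin m` and monadic second-order
variables `Fin n`. -/
inductive Fml : ℕ → ℕ → Type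
  | eq {m n : ℕ} (i j : Fin m) : Fml m n
  | lt {m n : ℕ} (i j : Fin m) : Fml m n
  | B {m n : ℕ} (i j : Fin m) : Fml m n
  | P {m n : ℕ} (i : Fin m) : Fml m n
  | X {m n : ℕ} (x : Fin n) (i : Fin m) : Fml m n
  | not {m n : ℕ} (φ : Fml m n) : Fml m n
  | and {m n : ℕ} (φ ψ : Fml m n) : Fml m n
  | exFO {m n : ℕ} (φ : Fml (m + 1) n) : Fml m n
  | exSO {m n : ℕ} (φ : Fml m (n + 1)) : Fml m n

/-- Satisfaction of an `L`-formula in a structure with domain `D`, order `lo`,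
binary relation `Bo` and unary predicate `Pred`, under assignments `v` (first-order)
and `w` (second-order). -/
def Fml.Sat {D : Type} (lo Bo : D → D → Prop) (Pred : Set D) :
    ∀ {m n : ℕ}, Fml m n → (Fin m → D) → (Fin n → Set D) → Prop
  | _, _, .eq i j, v, _ => v i = v j
  | _, _, .lt i j, v, _ => lo (v i) (v j)
  | _, _, .B i j, v, _ => Bo (v i) (v j)
  | _, _, .P i, v, _ => v i ∈ Pred
  | _, _, .X x i, v, w => v i ∈ w x
  | _, _, .not φ, v, w => ¬ Fml.Sat lo Bo Pred φ v w
  | _, _, .and φ ψ, v, w => Fml.Sat lo Bo Pred φ v w ∧ Fml.Sat lo Bo Pred ψ v w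
  | _, _, .exFO φ, v, w => ∃ d : D, Fml.Sat lo Bo Pred φ (Fin.cons d v) w
  | _, _, .exSO φ, v, w => ∃ A : Set D, Fml.Sat lo Bo Pred φ v (Fin.cons A w)

/-- Quantifier depth (counting both first- and second-order quantifiers). -/
def Fml.qd : ∀ {m n : ℕ}, Fml m n → ℕ
  | _, _, .eq _ _ => 0
  | _, _, .lt _ _ => 0
  | _, _, .B _ _ => 0
  | _, _, .P _ => 0
  | _, _, .X _ _ => 0
  | _, _, .not φ => φ.qd
  | _, _, .and φ ψ => max φ.qd ψ.qd
  | _, _, .exFO φ => φ.qd + 1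
  | _, _, .exSO φ => φ.qd + 1

/-- Satisfaction over the real line: `<` is the usual order and `B(t,s) ↔ s = t + 1`. -/
def Fml.SatR (Pred : Set ℝ) {m n : ℕ} (φ : Fml m n)
    (v : Fin m → ℝ) (w : Fin n → Set ℝ) : Prop :=
  Fml.Sat (· < ·) (fun t s => s = t + 1) Pred φ v w

/-- The set `P_k = {m/k : m ∈ ℤ}`, the interpretation of `P` in the model `M_k`. -/
def Pk (k : ℕ) : Set ℝ := {x : ℝ | ∃ m : ℤ, x = m / k}

/-- Formulas of the temporal logic `TL_n`: built from the atom `p` and `⊤` by Boolean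
connectives and applications of modalities whose truth tables are `L`-formulas with one
free first-order variable, `j` free monadic variables, and quantifier depth at most `n`. -/
inductive TL (n : ℕ) : Type
  | top : TL n
  | atom : TL n
  | not : TL n → TL n
  | and : TL n → TL n → TL n
  | mod : (j : ℕ) → (O : Fml 1 j) → O.qd ≤ n → (Fin j → TL n) → TL n

/-- The truth set of a `TL_n` formula in the structure `(ℝ, <, B, P)` with `P`
interpreted as `Pred`. -/
def TL.truth {n : ℕ} (Pred : Set ℝ) : TL n → Set ℝ
  | .top => Set.univ
  | .atom => Pred
  | .not φ => (TL.truth Pred φ)ᶜ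
  | .and φ ψ => TL.truth Pred φ ∩ TL.truth Pred ψ
  | .mod _ O _ args =>
      {t : ℝ | Fml.SatR Pred O (fun _ => t) (fun i => TL.truth Pred (args i))}

/-- Renaming of second-order variables. -/
def Fml.rename : ∀ {m n n' : ℕ}, (Fin n → Fin n') → Fml m n → Fml m n'
  | _, _, _, _, .eq i j => .eq i j
  | _, _, _, _, .lt i j => .lt i j
  | _, _, _, _, .B i j => .B i j
  | _, _, _, _, .P i => .P i
  | _, _, _, g, .X x i => .X (g x) i
  | _, _, _, g, .not φ => .not (φ.rename g)
  | _, _, _, g, .and φ ψ => .and (φ.rename g) (ψ.rename g)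
  | _, _, _, g, .exFO φ => .exFO (φ.rename g)
  | _, _, _, g, .exSO φ => .exSO (φ.rename (Fin.cons 0 (fun i => (g i).succ)))

theorem Fml.qd_rename {m n : ℕ} (φ : Fml m n) :
    ∀ {n' : ℕ} (g : Fin n → Fin n'), (φ.rename g).qd = φ.qd := by
  induction φ <;> intro n' g <;> simp_all [Fml.rename, Fml.qd]

theorem Fml.sat_rename {D : Type} {lo Bo : D → D → Prop} {Pred : Set D} {m n : ℕ}
    (φ : Fml m n) : ∀ {n' : ℕ} (g : Fin n → Fin n') (v : Fin m → D) (w : Fin n' → Set D),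
      (φ.rename g).Sat lo Bo Pred v w ↔ φ.Sat lo Bo Pred v (fun i => w (g i)) := by
  induction φ with
  | exSO φ ih =>
    intro n' g v w
    simp only [Fml.rename, Fml.Sat]
    refine exists_congr fun A => ?_
    rw [ih]
    suffices h : (fun i => (Fin.cons A w : Fin (n' + 1) → Set D)
        ((Fin.cons 0 (fun i => (g i).succ) : Fin _ → Fin (n' + 1)) i)) =
        Fin.cons A (fun i => w (g i)) by rw [h]
    funext i
    refine Fin.cases ?_ (fun i => ?_) i <;> simp
  | _ => intros; simp_all [Fml.rename, Fml.Sat]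

/-- Satisfaction is invariant under automorphisms. -/
theorem Fml.sat_equiv {D : Type} {lo Bo : D → D → Prop} {Pred : Set D} (e : D ≃ D)
    (hlo : ∀ x y, lo (e x) (e y) ↔ lo x y) (hBo : ∀ x y, Bo (e x) (e y) ↔ Bo x y)
    (hP : ∀ x, e x ∈ Pred ↔ x ∈ Pred) {m n : ℕ} (φ : Fml m n) :
    ∀ (v v' : Fin m → D) (w w' : Fin n → Set D), (∀ i, v' i = e (v i)) →
      (∀ i x, e x ∈ w' i ↔ x ∈ w i) →
      (φ.Sat lo Bo Pred v w ↔ φ.Sat lo Bo Pred v' w') := by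
  induction φ with
  | exFO φ ih =>
    intro v v' w w' hv hw
    simp only [Fml.Sat]
    refine e.exists_congr fun d => ih _ _ _ _ (fun i => ?_) hw
    refine Fin.cases ?_ (fun i => ?_) i <;> simp [hv]
  | exSO φ ih =>
    intro v v' w w' hv hw
    simp only [Fml.Sat]
    constructor
    · rintro ⟨A, h⟩
      refine ⟨e.symm ⁻¹' A, (ih _ _ _ _ hv fun i => ?_).1 h⟩
      refine Fin.cases ?_ (fun i => ?_) i <;> simp [hw]
    · rintro ⟨A, h⟩
      refine ⟨e ⁻¹' A, (ih _ _ _ _ hv fun i => ?_).2 h⟩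
      refine Fin.cases ?_ (fun i => ?_) i <;> simp [hw]
  | not φ ih =>
    intro v v' w w' hv hw
    exact not_congr (ih v v' w w' hv hw)
  | and φ ψ ih₁ ih₂ =>
    intro v v' w w' hv hw
    exact and_congr (ih₁ v v' w w' hv hw) (ih₂ v v' w w' hv hw)
  | _ => intro v v' w w' hv hw; simp [Fml.Sat, hv, hlo, hBo, hP, hw]

/-- The atomic facts about an assignment. -/
def atomicType {D : Type} (lo Bo : D → D → Prop) (Pred : Set D) {m n : ℕ}
    (v : Fin m → D) (w : Fin n → Set D) :
    ((Fin m → Fin m → Prop) × (Fin m → Fin m → Prop) × (Fin m → Fin m → Prop)) ×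
      (Fin m → Prop) × (Fin n → Fin m → Prop) :=
  ((fun i j => v i = v j, fun i j => lo (v i) (v j), fun i j => Bo (v i) (v j)),
    fun i => v i ∈ Pred, fun x i => v i ∈ w x)

/-- Up to agreement on formulas of quantifier depth at most `r`, there are only finitely many
assignments in expansions of a fixed structure by a unary predicate. -/
theorem exists_finite_type {D : Type} (lo Bo : D → D → Prop) (r : ℕ) : ∀ m n : ℕ,
    ∃ (τ : Type) (_ : Finite τ) (f : Set D → (Fin m → D) → (Fin n → Set D) → τ),
      ∀ (Q Q' : Set D) v v' w w', f Q v w = f Q' v' w' → ∀ φ : Fml m n, φ.qd ≤ r →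
        (φ.Sat lo Bo Q v w ↔ φ.Sat lo Bo Q' v' w') := by
  induction r with
  | zero =>
    intro m n
    refine ⟨_, inferInstance, fun Q v w => atomicType lo Bo Q v w, ?_⟩
    intro Q Q' v v' w w' h φ hφ
    simp only [atomicType, Prod.mk.injEq, funext_iff, eq_iff_iff] at h
    obtain ⟨⟨h1, h2, h3⟩, h4, h5⟩ := h
    induction φ with
    | not φ ih => exact not_congr (ih v v' w w' hφ h1 h2 h3 h4 h5)
    | and φ ψ ih₁ ih₂ =>
      simp only [Fml.qd] at hφ
      exact and_congr (ih₁ v v' w w' (by omega) h1 h2 h3 h4 h5)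
        (ih₂ v v' w w' (by omega) h1 h2 h3 h4 h5)
    | exFO φ ih => simp [Fml.qd] at hφ
    | exSO φ ih => simp [Fml.qd] at hφ
    | _ => simp only [Fml.Sat, h1, h2, h3, h4, h5]
  | succ r ih =>
    intro m n
    obtain ⟨τ₁, _, f₁, hf₁⟩ := ih (m + 1) n
    obtain ⟨τ₂, _, f₂, hf₂⟩ := ih m (n + 1)
    refine ⟨_ × Set τ₁ × Set τ₂, inferInstance, fun Q v w => (atomicType lo Bo Q v w,
      Set.range fun d => f₁ Q (Fin.cons d v) w, Set.range fun A => f₂ Q v (Fin.cons A w)), ?_⟩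
    intro Q Q' v v' w w' h φ hφ
    simp only [Prod.mk.injEq] at h
    obtain ⟨h0, hr₁, hr₂⟩ := h
    simp only [atomicType, Prod.mk.injEq, funext_iff, eq_iff_iff] at h0
    obtain ⟨⟨h1, h2, h3⟩, h4, h5⟩ := h0
    induction φ with
    | not φ ih => exact not_congr (ih f₁ hf₁ f₂ hf₂ v v' w w' hφ hr₁ hr₂ h1 h2 h3 h4 h5)
    | and φ ψ ih₁ ih₂ =>
      simp only [Fml.qd] at hφ
      exact and_congr (ih₁ f₁ hf₁ f₂ hf₂ v v' w w' (by omega) hr₁ hr₂ h1 h2 h3 h4 h5)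
        (ih₂ f₁ hf₁ f₂ hf₂ v v' w w' (by omega) hr₁ hr₂ h1 h2 h3 h4 h5)
    | exFO φ _ =>
      simp only [Fml.qd, add_le_add_iff_right] at hφ
      simp only [Fml.Sat]
      constructor
      · rintro ⟨d, hd⟩
        obtain ⟨d', hd'⟩ := hr₁.subset ⟨d, rfl⟩
        exact ⟨d', (hf₁ _ _ _ _ _ _ hd' φ hφ).2 hd⟩
      · rintro ⟨d, hd⟩
        obtain ⟨d', hd'⟩ := hr₁.superset ⟨d, rfl⟩
        exact ⟨d', (hf₁ _ _ _ _ _ _ hd' φ hφ).2 hd⟩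
    | exSO φ _ =>
      simp only [Fml.qd, add_le_add_iff_right] at hφ
      simp only [Fml.Sat]
      constructor
      · rintro ⟨A, hA⟩
        obtain ⟨A', hA'⟩ := hr₂.subset ⟨A, rfl⟩
        exact ⟨A', (hf₂ _ _ _ _ _ _ hA' φ hφ).2 hA⟩
      · rintro ⟨A, hA⟩
        obtain ⟨A', hA'⟩ := hr₂.superset ⟨A, rfl⟩
        exact ⟨A', (hf₂ _ _ _ _ _ _ hA' φ hφ).2 hA⟩
    | _ => simp only [Fml.Sat, h1, h2, h3, h4, h5]

/-- A projective automorphism of the unit interval, extended to `ℝ` so as to commute with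
integer translations. -/
noncomputable def warp (c x : ℝ) : ℝ := ⌊x⌋ + Int.fract x / (Int.fract x + c * (1 - Int.fract x))

theorem warp_den_pos {c y : ℝ} (hc : 0 < c) (h0 : 0 ≤ y) (h1 : y < 1) :
    0 < y + c * (1 - y) := by
  have := mul_pos hc (sub_pos.2 h1)
  linarith

theorem warp_term_mem {c y : ℝ} (hc : 0 < c) (h0 : 0 ≤ y) (h1 : y < 1) :
    y / (y + c * (1 - y)) ∈ Set.Ico (0 : ℝ) 1 := by
  have h := warp_den_pos hc h0 h1
  refine ⟨by positivity, (div_lt_one h).2 ?_⟩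
  have := mul_pos hc (sub_pos.2 h1)
  linarith

theorem warp_strictMono {c : ℝ} (hc : 0 < c) : StrictMono (warp c) := by
  intro x y hxy
  have hx := warp_term_mem hc (Int.fract_nonneg x) (Int.fract_lt_one x)
  have hy := warp_term_mem hc (Int.fract_nonneg y) (Int.fract_lt_one y)
  unfold warp
  rcases (Int.floor_mono hxy.le).eq_or_lt with h | h
  · rw [h]
    have hf : Int.fract x < Int.fract y := by
      rw [Int.fract, Int.fract, h]; linarith
    refine add_lt_add_right ?_ _
    rw [div_lt_div_iff₀ (warp_den_pos hc (Int.fract_nonneg x) (Int.fract_lt_one x))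
      (warp_den_pos hc (Int.fract_nonneg y) (Int.fract_lt_one y))]
    nlinarith [mul_pos hc (sub_pos.2 hf)]
  · have h' : (⌊x⌋ : ℝ) + 1 ≤ ⌊y⌋ := by exact_mod_cast h
    linarith [hx.2, hy.1]

theorem warp_add_intCast (c x : ℝ) (m : ℤ) : warp c (x + m) = warp c x + m := by
  simp only [warp, Int.floor_add_intCast, Int.fract_add_intCast, Int.cast_add]
  ring

theorem warp_of_mem_Ico {c y : ℝ} (h : y ∈ Set.Ico (0 : ℝ) 1) :
    warp c y = y / (y + c * (1 - y)) := by
  simp [warp, Int.floor_eq_zero_iff.2 h, Int.fract_eq_self.2 h]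

theorem warp_surjective {c : ℝ} (hc : 0 < c) : Function.Surjective (warp c) := by
  intro y
  have h0 := Int.fract_nonneg y
  have h1 := Int.fract_lt_one y
  have hm := warp_term_mem (inv_pos.2 hc) h0 h1
  have hd := warp_den_pos (inv_pos.2 hc) h0 h1
  refine ⟨Int.fract y / (Int.fract y + c⁻¹ * (1 - Int.fract y)) + ⌊y⌋, ?_⟩
  rw [warp_add_intCast, warp_of_mem_Ico hm]
  refine Eq.trans ?_ (Int.fract_add_floor y)
  congr 1
  generalize Int.fract y = z at *
  have hd' := (warp_den_pos hc hm.1 hm.2).ne'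
  rw [div_eq_iff hd']
  have hd'' := hd.ne'
  field_simp
  ring

theorem warp_zero (c : ℝ) : warp c 0 = 0 := by simp [warp]

theorem warp_intCast (c : ℝ) (m : ℤ) : warp c m = m := by
  simpa [warp_zero] using warp_add_intCast c 0 m

theorem mem_Pk_iff {k : ℕ} (hk : 0 < k) {x : ℝ} : x ∈ Pk k ↔ ∃ m : ℤ, k * x = m := by
  have hk' : (k : ℝ) ≠ 0 := by positivity
  refine exists_congr fun m => ?_
  rw [eq_div_iff hk', mul_comm]

theorem zero_mem_Pk (k : ℕ) : (0 : ℝ) ∈ Pk k := ⟨0, by simp⟩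

theorem half_notMem_Pk {k : ℕ} (hk : 0 < k) : 1 / (2 * k : ℝ) ∉ Pk k := by
  have hk' : (k : ℝ) ≠ 0 := by positivity
  rw [mem_Pk_iff hk]
  rintro ⟨m, hm⟩
  have : (1 : ℝ) = 2 * m := by rw [← hm]; field_simp
  have : (1 : ℤ) = 2 * m := by exact_mod_cast this
  omega

theorem exists_automorphism {k : ℕ} (hk : 0 < k) {c : ℝ} (hc : 0 < c) (m : ℤ) :
    ∃ e : ℝ ≃ ℝ, (∀ x y, e x < e y ↔ x < y) ∧ (∀ x y, e y = e x + 1 ↔ y = x + 1) ∧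
      (∀ x, e x ∈ Pk k ↔ x ∈ Pk k) ∧ ∀ x, e x = (m + warp c (k * x)) / k := by
  have hk' : (0 : ℝ) < k := by positivity
  have hmono : StrictMono fun x : ℝ => (m + warp c (k * x)) / k := by
    intro x y hxy
    have := warp_strictMono hc (mul_lt_mul_of_pos_left hxy hk')
    simp only
    gcongr
  have hsurj : Function.Surjective fun x : ℝ => (m + warp c (k * x)) / k := by
    intro y
    obtain ⟨z, hz⟩ := warp_surjective hc (k * y - m)
    refine ⟨z / k, ?_⟩
    simp only [mul_div_cancel₀ z hk'.ne', hz]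
    field_simp
    ring
  obtain ⟨e, he⟩ : ∃ e : ℝ ≃ ℝ, ∀ x, e x = (m + warp c (k * x)) / k :=
    ⟨Equiv.ofBijective _ ⟨hmono.injective, hsurj⟩, fun _ => rfl⟩
  refine ⟨e, fun x y => ?_, fun x y => ?_, fun x => ?_, he⟩
  · rw [he, he]
    exact hmono.lt_iff_lt
  · have h : (m + warp c (k * x)) / k + 1 = (m + warp c (k * (x + 1))) / k := by
      have := warp_add_intCast c (k * x) k
      push_cast at this
      rw [mul_add, mul_one, this]
      field_simp
      ring
    rw [he, he, h]
    exact hmono.injective.eq_iff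
  · simp only [he, mem_Pk_iff hk, mul_div_cancel₀ _ hk'.ne']
    constructor
    · rintro ⟨j, hj⟩
      refine ⟨j - m, (warp_strictMono hc).injective ?_⟩
      rw [warp_intCast]
      push_cast
      linarith
    · rintro ⟨j, hj⟩
      refine ⟨m + j, ?_⟩
      rw [hj, warp_intCast]
      push_cast
      rfl

/-- Automorphisms act transitively on `Pk k` and on its complement. -/
theorem exists_automorphism_apply_eq {k : ℕ} (hk : 0 < k) {s t : ℝ}
    (hs : s = 0 ∧ t ∈ Pk k ∨ s = 1 / (2 * k) ∧ t ∉ Pk k) :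
    ∃ e : ℝ ≃ ℝ, (∀ x y, e x < e y ↔ x < y) ∧ (∀ x y, e y = e x + 1 ↔ y = x + 1) ∧
      (∀ x, e x ∈ Pk k ↔ x ∈ Pk k) ∧ e s = t := by
  have hk' : (0 : ℝ) < k := by positivity
  rcases hs with ⟨rfl, m, rfl⟩ | ⟨rfl, ht⟩
  · obtain ⟨e, h1, h2, h3, h4⟩ := exists_automorphism hk one_pos m
    exact ⟨e, h1, h2, h3, by simp [h4, warp_zero]⟩
  · have hu : 0 < Int.fract (k * t) := by
      refine (Int.fract_nonneg _).lt_of_ne' fun h => ht ((mem_Pk_iff hk).2 ⟨⌊k * t⌋, ?_⟩)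
      simpa [h] using (Int.fract_add_floor (k * t)).symm
    have hu1 := sub_pos.2 (Int.fract_lt_one (k * t))
    obtain ⟨e, h1, h2, h3, h4⟩ := exists_automorphism hk (div_pos hu1 hu) ⌊k * t⌋
    refine ⟨e, h1, h2, h3, ?_⟩
    have hhalf : (k : ℝ) * (1 / (2 * k)) = 1 / 2 := by field_simp
    rw [h4, hhalf, warp_of_mem_Ico (by norm_num), div_eq_iff hk'.ne', mul_comm t]
    refine Eq.trans ?_ (Int.floor_add_fract (k * t))
    congr 1
    field_simp
    ring

/-- The four sets that are unions of `P` and its complement. -/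
def cells (P : Set ℝ) : Fin 4 → Set ℝ := ![∅, P, Pᶜ, Set.univ]

theorem exists_cells_eq (a b : Prop) :
    ∃ i, ∀ P : Set ℝ, cells P i = {t | t ∈ P ∧ a ∨ t ∉ P ∧ b} := by
  by_cases ha : a <;> by_cases hb : b
  · exact ⟨3, fun P => by ext t; simp [cells, ha, hb, em]⟩
  · exact ⟨1, fun P => by ext t; simp [cells, ha, hb]⟩
  · exact ⟨2, fun P => by ext t; simp [cells, ha, hb]⟩
  · exact ⟨0, fun P => by ext t; simp [cells, ha, hb]⟩

theorem mem_cells_congr {P : Set ℝ} {s t : ℝ} (h : s ∈ P ↔ t ∈ P) (i : Fin 4) :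
    s ∈ cells P i ↔ t ∈ cells P i := by
  fin_cases i <;> simp [cells, h]

theorem satR_cells_iff {k : ℕ} (hk : 0 < k) (O : Fml 1 4) {s t : ℝ}
    (hs : s = 0 ∧ t ∈ Pk k ∨ s = 1 / (2 * k) ∧ t ∉ Pk k) :
    O.SatR (Pk k) (fun _ => s) (cells (Pk k)) ↔ O.SatR (Pk k) (fun _ => t) (cells (Pk k)) := by
  obtain ⟨e, h1, h2, h3, h4⟩ := exists_automorphism_apply_eq hk hs
  exact O.sat_equiv e h1 h2 h3 _ _ _ _ (fun _ => h4.symm) fun i x => mem_cells_congr (h3 x) i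

/-- If depth-`n` formulas do not distinguish `Pk k` from `Pk k'`, every `TL n` formula defines
the same Boolean combination of the atom over both. -/
theorem TL.truth_uniform {n k k' : ℕ} (hk : 0 < k) (hk' : 0 < k')
    (h0 : ∀ O : Fml 1 4, O.qd ≤ n → (O.SatR (Pk k) (fun _ => 0) (cells (Pk k)) ↔
      O.SatR (Pk k') (fun _ => 0) (cells (Pk k'))))
    (h1 : ∀ O : Fml 1 4, O.qd ≤ n → (O.SatR (Pk k) (fun _ => 1 / (2 * k)) (cells (Pk k)) ↔
      O.SatR (Pk k') (fun _ => 1 / (2 * k')) (cells (Pk k'))))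
    (φ : TL n) : ∃ i : Fin 4, φ.truth (Pk k) = cells (Pk k) i ∧
      φ.truth (Pk k') = cells (Pk k') i := by
  induction φ with
  | top => exact ⟨3, rfl, rfl⟩
  | atom => exact ⟨1, rfl, rfl⟩
  | not φ ih =>
    obtain ⟨i, hi, hi'⟩ := ih
    simp only [TL.truth, hi, hi']
    fin_cases i
    · exact ⟨3, by simp [cells], by simp [cells]⟩
    · exact ⟨2, by simp [cells], by simp [cells]⟩
    · exact ⟨1, by simp [cells], by simp [cells]⟩
    · exact ⟨0, by simp [cells], by simp [cells]⟩
  | and φ ψ ih₁ ih₂ =>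
    obtain ⟨i, hi, hi'⟩ := ih₁
    obtain ⟨j, hj, hj'⟩ := ih₂
    simp only [TL.truth, hi, hi', hj, hj']
    fin_cases i
    · exact ⟨0, by simp [cells], by simp [cells]⟩
    · fin_cases j
      · exact ⟨0, by simp [cells], by simp [cells]⟩
      · exact ⟨1, by simp [cells], by simp [cells]⟩
      · exact ⟨0, by simp [cells], by simp [cells]⟩
      · exact ⟨1, by simp [cells], by simp [cells]⟩
    · fin_cases j
      · exact ⟨0, by simp [cells], by simp [cells]⟩
      · exact ⟨0, by simp [cells], by simp [cells]⟩
      · exact ⟨2, by simp [cells], by simp [cells]⟩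
      · exact ⟨2, by simp [cells], by simp [cells]⟩
    · exact ⟨j, by simp [cells], by simp [cells]⟩
  | mod j O hO args ih =>
    choose c hc hc' using ih
    have hO' : (O.rename c).qd ≤ n := by rwa [Fml.qd_rename]
    obtain ⟨i, hi⟩ := exists_cells_eq
      ((O.rename c).SatR (Pk k) (fun _ => 0) (cells (Pk k)))
      ((O.rename c).SatR (Pk k) (fun _ => 1 / (2 * k)) (cells (Pk k)))
    have key : ∀ (l : ℕ) (t : ℝ), O.SatR (Pk l) (fun _ => t) (fun x => cells (Pk l) (c x)) ↔
        (O.rename c).SatR (Pk l) (fun _ => t) (cells (Pk l)) :=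
      fun l t => (O.sat_rename c _ _).symm
    refine ⟨i, ?_, ?_⟩
    · ext t
      simp only [TL.truth, hc, hi, key, Set.mem_ofPred_eq]
      by_cases ht : t ∈ Pk k
      · simp [ht, satR_cells_iff hk _ (.inl ⟨rfl, ht⟩)]
      · simp only [ht, ← satR_cells_iff hk _ (.inr ⟨rfl, ht⟩)]
        simp
    · ext t
      simp only [TL.truth, hc', hi, key, Set.mem_ofPred_eq, h0 _ hO', h1 _ hO']
      by_cases ht : t ∈ Pk k'
      · simp [ht, satR_cells_iff hk' _ (.inl ⟨rfl, ht⟩)]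
      · simp only [ht, ← satR_cells_iff hk' _ (.inr ⟨rfl, ht⟩)]
        simp

theorem encard_Pk_inter_Ioo_le {k : ℕ} (hk : 0 < k) (t : ℝ) :
    (Pk k ∩ Set.Ioo t (t + 1)).encard ≤ k := by
  have hk' : (0 : ℝ) < k := by positivity
  have hsub : Pk k ∩ Set.Ioo t (t + 1) ⊆
      (fun m : ℤ => (m : ℝ) / k) '' (Finset.Ioc ⌊t * k⌋ (⌊t * k⌋ + k) : Set ℤ) := by
    rintro _ ⟨⟨m, rfl⟩, hm1, hm2⟩
    refine ⟨m, ?_, rfl⟩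
    rw [lt_div_iff₀ hk'] at hm1
    rw [div_lt_iff₀ hk', add_mul, one_mul] at hm2
    have h1 : ⌊t * k⌋ < m := Int.floor_lt.2 hm1
    have h2 : m ≤ ⌊t * k + k⌋ := Int.le_floor.2 hm2.le
    rw [Int.floor_add_natCast] at h2
    simp [h1, h2]
  refine (Set.encard_le_encard hsub).trans ((Set.encard_image_le _ _).trans ?_)
  rw [Set.encard_coe_eq_coe_finsetCard]
  simp

theorem le_encard_Pk_inter_Ioo {k : ℕ} (hk : 0 < k) :
    (k : ℕ∞) ≤ (Pk k ∩ Set.Ioo (1 / (2 * k) : ℝ) (1 / (2 * k) + 1)).encard := by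
  have hk' : (0 : ℝ) < k := by positivity
  have hinj : Function.Injective fun m : ℤ => (m : ℝ) / k := by
    intro a b hab
    simpa [hk'.ne'] using hab
  have hsub : (fun m : ℤ => (m : ℝ) / k) '' (Finset.Icc 1 (k : ℤ) : Set ℤ) ⊆
      Pk k ∩ Set.Ioo (1 / (2 * k) : ℝ) (1 / (2 * k) + 1) := by
    rintro _ ⟨m, hm, rfl⟩
    simp only [Finset.coe_Icc, Set.mem_Icc] at hm
    have hm1 : (1 : ℝ) ≤ m := by exact_mod_cast hm.1
    have hm2 : (m : ℝ) ≤ k := by exact_mod_cast hm.2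
    refine ⟨⟨m, rfl⟩, ?_, ?_⟩
    · rw [div_lt_div_iff₀ (by positivity) hk']
      nlinarith
    · have h1 : (m : ℝ) / k ≤ 1 := (div_le_one hk').2 hm2
      have h2 : (0 : ℝ) < 1 / (2 * k) := by positivity
      linarith
  refine le_trans ?_ (Set.encard_le_encard hsub)
  rw [hinj.encard_image, Set.encard_coe_eq_coe_finsetCard]
  simp

/-- For every `n` there is `k` such that the counting modality `C_k` is not expressible
in `TL_n` over the real line: no temporal logic all of whose modalities have truth tables
of quantifier depth at most `n` in `L` can express all the counting modalities. -/
theorem counting_not_expressible_in_TLn (n : ℕ) :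
    ∃ k : ℕ, ¬ ∃ φ : TL n, ∀ P : Set ℝ,
      TL.truth P φ = {t : ℝ | (k : ℕ∞) ≤ (P ∩ Set.Ioo t (t + 1)).encard} := by
  obtain ⟨τ, _, f, hf⟩ := exists_finite_type (D := ℝ) (· < ·) (fun t s => s = t + 1) n 1 4
  obtain ⟨a, b, hab, hfab⟩ := Finite.exists_ne_map_eq_of_infinite fun k : ℕ =>
    (f (Pk (k + 1)) (fun _ => 0) (cells (Pk (k + 1))),
      f (Pk (k + 1)) (fun _ => 1 / (2 * (k + 1 : ℕ))) (cells (Pk (k + 1))))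
  wlog hlt : a < b generalizing a b
  · exact this b a hab.symm hfab.symm (by omega)
  simp only [Prod.mk.injEq] at hfab
  refine ⟨a + 2, ?_⟩
  rintro ⟨φ, hφ⟩
  obtain ⟨i, hi, hi'⟩ := TL.truth_uniform a.succ_pos b.succ_pos
    (hf _ _ _ _ _ _ hfab.1) (hf _ _ _ _ _ _ hfab.2) φ
  have hempty : ∀ t, t ∉ cells (Pk (a + 1)) i := by
    intro t ht
    rw [← hi, hφ] at ht
    have := le_trans ht (encard_Pk_inter_Ioo_le a.succ_pos t)
    norm_cast at this
    omega
  have hmem : 1 / (2 * (b + 1 : ℕ) : ℝ) ∈ cells (Pk (b + 1)) i := by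
    rw [← hi', hφ]
    refine le_trans ?_ (le_encard_Pk_inter_Ioo b.succ_pos)
    norm_cast
    omega
  have h0 := hempty 0
  have h1 := hempty (1 / (2 * (a + 1 : ℕ)))
  have hz := zero_mem_Pk (a + 1)
  have hh := half_notMem_Pk a.succ_pos
  fin_cases i
  · exact hmem
  · exact h0 hz
  · exact h1 hh
  · exact h0 trivial
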